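/- arXiv:2210.09936 — 2 statements merged into one kernel-verified Lean document; each statement's English description precedes it below -/
import Mathlib

section
/- The Paley tournament on 11 vertices is not 3-colorable: its vertex set cannot be partitioned into three transitive subsets. -/
def IsTournament {V : Type*} (r : V → V → Prop) : Prop :=
  (∀ v, ¬ r v v) ∧ ∀ u v : V, u ≠ v → (r u v ↔ ¬ r v u)

def TransOn {V : Type*} (r : V → V → Prop) (S : Set V) : Prop :=
  ∀ a ∈ S, ∀ b ∈ S, ∀ c ∈ S, r a b → r b c → r a c

def Colorable {V : Type*} (r : V → V → Prop) (k : ℕ) : Prop :=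
  ∃ f : V → Fin k, ∀ c : Fin k, TransOn r {v | f v = c}

def pal11 (i j : ZMod 11) : Prop :=
  i - j = 1 ∨ i - j = 3 ∨ i - j = 4 ∨ i - j = 5 ∨ i - j = 9

instance : DecidableRel pal11 := fun i j =>
  inferInstanceAs (Decidable (i - j = 1 ∨ i - j = 3 ∨ i - j = 4 ∨ i - j = 5 ∨ i - j = 9))

/-- `v` lies on a directed triangle whose other two vertices belong to `A`. -/
def closesTriangle (v : ZMod 11) (A : List (ZMod 11)) : Bool :=
  A.any fun a => decide (pal11 v a) && A.any fun b => decide (pal11 a b) && decide (pal11 b v)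

/-- Backtracking search: the vertices of the first list cannot be distributed one by one over the
classes `A`, `B`, `C` without closing a directed triangle inside a class. -/
def notDistributable :
    List (ZMod 11) → List (ZMod 11) → List (ZMod 11) → List (ZMod 11) → Bool
  | [], _, _, _ => false
  | v :: vs, A, B, C =>
    (closesTriangle v A || notDistributable vs (v :: A) B C) &&
    ((closesTriangle v B || notDistributable vs A (v :: B) C) &&
    (closesTriangle v C || notDistributable vs A B (v :: C)))

theorem pal11_asymm {u v : ZMod 11} : pal11 u v → ¬ pal11 v u := by
  revert u v; decide

theorem closesTriangle_eq_false {S : Set (ZMod 11)} (hS : TransOn pal11 S) {v : ZMod 11}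
    (hv : v ∈ S) {A : List (ZMod 11)} (hA : ∀ a ∈ A, a ∈ S) : closesTriangle v A = false := by
  rw [Bool.eq_false_iff]
  intro h
  simp only [closesTriangle, List.any_eq_true, Bool.and_eq_true, decide_eq_true_eq] at h
  obtain ⟨a, ha, hva, b, hb, hab, hbv⟩ := h
  exact pal11_asymm (hS v hv a (hA a ha) b (hA b hb) hva hab) hbv

theorem notDistributable_eq_false {f : ZMod 11 → Fin 3}
    (hf : ∀ c, TransOn pal11 {v | f v = c}) (vs : List (ZMod 11)) {A B C : List (ZMod 11)}
    (hA : ∀ a ∈ A, f a = 0) (hB : ∀ b ∈ B, f b = 1) (hC : ∀ c ∈ C, f c = 2) :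
    notDistributable vs A B C = false := by
  induction vs generalizing A B C with
  | nil => rfl
  | cons v vs ih =>
    have hv : f v = 0 ∨ f v = 1 ∨ f v = 2 := by
      generalize f v = c
      revert c
      decide
    rcases hv with hv | hv | hv
    · simp [notDistributable, closesTriangle_eq_false (hf 0) hv hA,
        ih (List.forall_mem_cons.2 ⟨hv, hA⟩) hB hC]
    · simp [notDistributable, closesTriangle_eq_false (hf 1) hv hB,
        ih hA (List.forall_mem_cons.2 ⟨hv, hB⟩) hC]
    · simp [notDistributable, closesTriangle_eq_false (hf 2) hv hC,
        ih hA hB (List.forall_mem_cons.2 ⟨hv, hC⟩)]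

theorem notDistributable_univ :
    notDistributable [0, 1, 2, 3, 4, 5, 6, 7, 8, 9, 10] [] [] [] = true := by
  decide +kernel

theorem stmt6 : ¬ Colorable pal11 3 := by
  rintro ⟨f, hf⟩
  have h := notDistributable_eq_false hf [0, 1, 2, 3, 4, 5, 6, 7, 8, 9, 10]
    (A := []) (B := []) (C := []) (by simp) (by simp) (by simp)
  rw [notDistributable_univ] at h
  exact Bool.noConfusion h
end

section
/- The Paley tournament on 11 vertices contains no transitive subtournament on 5 vertices. -/
theorem TransOn.mono {V : Type*} {r : V → V → Prop} {S T : Set V} (hT : TransOn r T)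
    (hST : S ⊆ T) : TransOn r S :=
  fun a ha b hb c hc => hT a (hST ha) b (hST hb) c (hST hc)

/-- A nonempty finite transitive subtournament has a source. -/
theorem IsTournament.exists_source {V : Type*} {r : V → V → Prop} (hr : IsTournament r)
    {S : Finset V} (hS : S.Nonempty) (htrans : TransOn r (S : Set V)) :
    ∃ a ∈ S, ∀ b ∈ S, b ≠ a → r a b := by
  classical
  induction hS using Finset.Nonempty.cons_induction with
  | singleton x => simp
  | cons x S hx hS ih =>
    obtain ⟨a, ha, hsource⟩ := ih (htrans.mono (by simp))
    by_cases hxa : r x a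
    · refine ⟨x, by simp, fun b hb hbx => ?_⟩
      have hbS : b ∈ S := (Finset.mem_cons.1 hb).resolve_left hbx
      rcases eq_or_ne b a with rfl | hba
      · exact hxa
      · exact htrans x (by simp) a (by simp [ha]) b (by simp [hbS]) hxa (hsource b hbS hba)
    · refine ⟨a, by simp [ha], fun b hb hba => ?_⟩
      rcases Finset.mem_cons.1 hb with rfl | hbS
      · exact (hr.2 a b hba.symm).2 hxa
      · exact hsource b hbS hba

/-- A transitive subtournament on `n + 1` vertices is a source joined to a transitive
subtournament on `n` vertices. -/
theorem IsTournament.exists_source_erase {V : Type*} [DecidableEq V] {r : V → V → Prop}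
    (hr : IsTournament r) {S : Finset V} {n : ℕ} (hcard : S.card = n + 1)
    (htrans : TransOn r (S : Set V)) :
    ∃ a, ∃ T ⊆ S, T.card = n ∧ TransOn r (T : Set V) ∧ a ∈ S ∧ ∀ b ∈ T, r a b := by
  obtain ⟨a, ha, hsource⟩ :=
    hr.exists_source (Finset.card_pos.1 (by omega)) htrans
  refine ⟨a, S.erase a, S.erase_subset a, by rw [Finset.card_erase_of_mem ha, hcard]; rfl,
    htrans.mono (by exact_mod_cast S.erase_subset a), ha, fun b hb => ?_⟩
  exact hsource b (Finset.mem_of_mem_erase hb) (Finset.ne_of_mem_erase hb)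

theorem isTournament_pal11 : IsTournament pal11 :=
  ⟨by decide, by decide +kernel⟩

theorem pal11_not_transitive_chain :
    ∀ a b, pal11 a b → ∀ c, pal11 a c → pal11 b c → ∀ d, pal11 a d → pal11 b d → pal11 c d →
      ∀ e, pal11 a e → pal11 b e → pal11 c e → ¬ pal11 d e := by
  decide +kernel

theorem stmt8 : ¬ ∃ S : Finset (ZMod 11), S.card = 5 ∧ TransOn pal11 ↑S := by
  rintro ⟨S, hcard, htrans⟩
  obtain ⟨a, A, -, hA, hAt, -, ha⟩ := isTournament_pal11.exists_source_erase hcard htrans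
  obtain ⟨b, B, hBA, hB, hBt, hbA, hb⟩ := isTournament_pal11.exists_source_erase hA hAt
  obtain ⟨c, C, hCB, hC, hCt, hcB, hc⟩ := isTournament_pal11.exists_source_erase hB hBt
  obtain ⟨d, D, hDC, hD, -, hdC, hd⟩ := isTournament_pal11.exists_source_erase hC hCt
  obtain ⟨e, heD⟩ := Finset.card_pos.1 (by omega : 0 < D.card)
  have heC := hDC heD
  have heB := hCB heC
  have hdB := hCB hdC
  exact pal11_not_transitive_chain a b (ha b hbA) c (ha c (hBA hcB)) (hb c hcB)
    d (ha d (hBA hdB)) (hb d hdB) (hc d hdC)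
    e (ha e (hBA heB)) (hb e heB) (hc e heC) (hd e heD)
end
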